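/- arXiv:2005.09994 — 4 statements merged into one kernel-verified Lean document; each statement's English description precedes it below -/
import Mathlib

section
/- For every realization of the sample X_1,…,X_n and every m ≥ 1, the function x ↦ F̂^S_{m,n}(x) is nondecreasing on [0,∞); together with F̂^S_{m,n}(0) = 0 and lim_{x→∞} F̂^S_{m,n}(x) = 1, the Szasz estimator is a proper continuous distribution function on [0,∞). -/
open Filter Topology

/-- The Szasz basis function `V_{k,m}(x) = e^{-mx} (mx)^k / k!`. -/
noncomputable def szaszV (m k : ℕ) (x : ℝ) : ℝ :=
  Real.exp (-(m * x)) * (m * x) ^ k / (Nat.factorial k)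

/-- The Szasz–Mirakyan operator `S_m(u;x) = ∑_{k=0}^∞ u(k/m) V_{k,m}(x)`. -/
noncomputable def szaszOp (u : ℝ → ℝ) (m : ℕ) (x : ℝ) : ℝ :=
  ∑' k : ℕ, u ((k : ℝ) / m) * szaszV m k x

/-- The empirical distribution function of the first `n` observations. -/
noncomputable def edf (X : ℕ → ℝ) (n : ℕ) (x : ℝ) : ℝ :=
  (n : ℝ)⁻¹ * ∑ i ∈ Finset.range n, if X i ≤ x then (1 : ℝ) else 0

/-- The Szasz estimator `F̂^S_{m,n}`. -/
noncomputable def szaszEst (X : ℕ → ℝ) (m n : ℕ) (x : ℝ) : ℝ :=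
  szaszOp (edf X n) m x

/-- The probability that a Poisson variable with mean `y` is less than `K`. -/
noncomputable def poissonLower (K : ℕ) (y : ℝ) : ℝ :=
  ∑ k ∈ Finset.range K, Real.exp (-y) * y ^ k / (Nat.factorial k)

theorem hasDerivAt_poissonLower_succ (K : ℕ) (y : ℝ) :
    HasDerivAt (poissonLower (K + 1)) (-(Real.exp (-y) * y ^ K / (Nat.factorial K))) y := by
  have hexp : HasDerivAt (fun y : ℝ => Real.exp (-y)) (-Real.exp (-y)) y := by
    simpa using (hasDerivAt_neg y).exp
  induction K with
  | zero =>
    have hfun : poissonLower (0 + 1) = fun y => Real.exp (-y) := by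
      funext y
      simp [poissonLower]
    simpa [hfun] using hexp
  | succ K ih =>
    have hfun : poissonLower (K + 1 + 1) = fun y => poissonLower (K + 1) y +
        Real.exp (-y) * y ^ (K + 1) / (Nat.factorial (K + 1)) := by
      funext y
      simp only [poissonLower, Finset.sum_range_succ _ (K + 1)]
    rw [hfun]
    refine (ih.add ((hexp.mul (hasDerivAt_pow (K + 1) y)).div_const _)).congr_deriv ?_
    rw [Nat.factorial_succ]
    have := Nat.factorial_ne_zero K
    push_cast
    field_simp
    ring

theorem continuous_poissonLower (K : ℕ) : Continuous (poissonLower K) := by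
  unfold poissonLower
  fun_prop

theorem antitoneOn_poissonLower (K : ℕ) : AntitoneOn (poissonLower K) (Set.Ici 0) := by
  cases K with
  | zero =>
    intro x _ y _ _
    simp [poissonLower]
  | succ K =>
    refine antitoneOn_of_deriv_nonpos (convex_Ici 0) (continuous_poissonLower _).continuousOn
      (fun y _ => (hasDerivAt_poissonLower_succ K y).differentiableAt.differentiableWithinAt) ?_
    intro y hy
    rw [interior_Ici, Set.mem_Ioi] at hy
    rw [(hasDerivAt_poissonLower_succ K y).deriv, neg_nonpos]
    positivity

theorem poissonLower_zero_right {K : ℕ} (hK : 0 < K) : poissonLower K 0 = 1 := by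
  unfold poissonLower
  rw [Finset.sum_eq_single_of_mem 0 (Finset.mem_range.2 hK)]
  · simp
  · intro k _ hk
    simp [hk]

theorem tendsto_poissonLower_atTop (K : ℕ) : Tendsto (poissonLower K) atTop (𝓝 0) := by
  unfold poissonLower
  rw [← Finset.sum_const_zero (s := Finset.range K)]
  refine tendsto_finsetSum _ fun k _ => ?_
  simpa [mul_comm] using
    (Real.tendsto_pow_mul_exp_neg_atTop_nhds_zero k).div_const (Nat.factorial k : ℝ)

theorem hasSum_szaszV (m : ℕ) (x : ℝ) : HasSum (fun k => szaszV m k x) 1 := by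
  have h := (NormedSpace.expSeries_div_hasSum_exp (m * x : ℝ)).mul_left (Real.exp (-(m * x)))
  rw [← Real.exp_eq_exp_ℝ, ← Real.exp_add, neg_add_cancel, Real.exp_zero] at h
  simpa [szaszV, mul_div_assoc] using h

theorem hasSum_indicator_mul_szaszV {m : ℕ} (hm : 1 ≤ m) (a x : ℝ) :
    HasSum (fun k : ℕ => (if a ≤ (k : ℝ) / m then (1 : ℝ) else 0) * szaszV m k x)
      (1 - poissonLower ⌈a * m⌉₊ (m * x)) := by
  have hm' : (0 : ℝ) < m := by exact_mod_cast hm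
  have h : HasSum (fun k : ℕ => if k < ⌈a * m⌉₊ then szaszV m k x else 0)
      (poissonLower ⌈a * m⌉₊ (m * x)) := by
    have hsum : poissonLower ⌈a * m⌉₊ (m * x) =
        ∑ k ∈ Finset.range ⌈a * m⌉₊, if k < ⌈a * m⌉₊ then szaszV m k x else 0 :=
      Finset.sum_congr rfl fun k hk => (if_pos (Finset.mem_range.1 hk)).symm
    rw [hsum]
    exact hasSum_sum_of_ne_finset_zero fun k hk => if_neg (by simpa using hk)
  refine ((hasSum_szaszV m x).sub h).congr_fun fun k => ?_
  simp only [le_div_iff₀ hm', ← Nat.ceil_le]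
  split_ifs <;> first | omega | simp

theorem szaszEst_eq_sum_poissonLower (X : ℕ → ℝ) {m : ℕ} (n : ℕ) (hm : 1 ≤ m) (x : ℝ) :
    szaszEst X m n x =
      (n : ℝ)⁻¹ * ∑ i ∈ Finset.range n, (1 - poissonLower ⌈X i * m⌉₊ (m * x)) := by
  have h := (hasSum_sum (s := Finset.range n) fun i _ =>
    hasSum_indicator_mul_szaszV hm (X i) x).mul_left (n : ℝ)⁻¹
  rw [← h.tsum_eq]
  simp only [szaszEst, szaszOp, edf, mul_assoc, Finset.sum_mul]

/-- For every realization of the (strictly positive) sample and every `m ≥ 1`, the Szasz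
estimator is nondecreasing on `[0,∞)`, vanishes at `0`, tends to `1` at infinity and is
continuous on `[0,∞)`: it is a proper continuous distribution function on `[0,∞)`. -/
theorem szaszEst_isDistributionFunction (X : ℕ → ℝ) (n m : ℕ) (hn : 1 ≤ n) (hm : 1 ≤ m)
    (hpos : ∀ i < n, 0 < X i) :
    MonotoneOn (fun x : ℝ => szaszEst X m n x) (Set.Ici (0 : ℝ)) ∧
    szaszEst X m n 0 = 0 ∧
    Tendsto (fun x : ℝ => szaszEst X m n x) atTop (𝓝 1) ∧
    ContinuousOn (fun x : ℝ => szaszEst X m n x) (Set.Ici (0 : ℝ)) := by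
  have hm' : (0 : ℝ) < m := by exact_mod_cast hm
  have hn' : (n : ℝ) ≠ 0 := by positivity
  simp only [szaszEst_eq_sum_poissonLower X n hm]
  refine ⟨?_, ?_, ?_, ?_⟩
  · intro x hx y hy hxy
    have hx' : (0 : ℝ) ≤ m * x := mul_nonneg hm'.le hx
    have hy' : (0 : ℝ) ≤ m * y := mul_nonneg hm'.le hy
    have hle : (m : ℝ) * x ≤ m * y := mul_le_mul_of_nonneg_left hxy hm'.le
    refine mul_le_mul_of_nonneg_left (Finset.sum_le_sum fun i _ => ?_) (by positivity)
    exact sub_le_sub_left (antitoneOn_poissonLower _ hx' hy' hle) 1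
  · rw [Finset.sum_eq_zero, mul_zero]
    intro i hi
    have hX := hpos i (Finset.mem_range.1 hi)
    rw [mul_zero, poissonLower_zero_right (Nat.ceil_pos.2 (by positivity)), sub_self]
  · have hlim : Tendsto (fun x : ℝ =>
        ∑ i ∈ Finset.range n, (1 - poissonLower ⌈X i * m⌉₊ (m * x))) atTop
        (𝓝 (∑ i ∈ Finset.range n, (1 - 0 : ℝ))) :=
      tendsto_finsetSum _ fun i _ => tendsto_const_nhds.sub
        ((tendsto_poissonLower_atTop _).comp (tendsto_id.const_mul_atTop hm'))
    simpa [hn'] using hlim.const_mul (n : ℝ)⁻¹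
  · have hc := continuous_poissonLower
    fun_prop
end

section
/- For each fixed x ∈ (0,∞), √(4πmx) · ∑_{k=0}^∞ V_{k,m}(x)² → 1 as m → ∞; equivalently, L_m^S(x) := ∑_{k=0}^∞ V_{k,m}(x)² = m^{-1/2}((4πx)^{-1/2} + o_x(1)). -/
open Filter Topology

/-- `L_m^S(x) = ∑_{k=0}^∞ V_{k,m}(x)²`. -/
noncomputable def szaszL (m : ℕ) (x : ℝ) : ℝ :=
  ∑' k : ℕ, (szaszV m k x) ^ 2

/-- Wallis' product in terms of factorials. -/
lemma integral_sin_pow_two_mul_eq_factorial (n : ℕ) :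
    ∫ θ in (0 : ℝ)..Real.pi, Real.sin θ ^ (2 * n) =
      Real.pi * ((2 * n).factorial / (4 ^ n * (n.factorial : ℝ) ^ 2)) := by
  rw [integral_sin_pow_even]
  congr 1
  induction n with
  | zero => simp
  | succ n ih =>
    rw [Finset.prod_range_succ, ih, show 2 * (n + 1) = 2 * n + 1 + 1 by ring,
      Nat.factorial_succ (2 * n + 1), Nat.factorial_succ (2 * n), Nat.factorial_succ n]
    have h : (n.factorial : ℝ) ≠ 0 := by positivity
    push_cast
    field_simp
    ring

/-- The integral representation of the modified Bessel function `I₀(2y)`. -/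
lemma hasSum_pow_div_factorial_sq (y : ℝ) :
    HasSum (fun k : ℕ => (y ^ k / k.factorial) ^ 2)
      (Real.pi⁻¹ * ∫ θ in (0 : ℝ)..Real.pi, Real.cosh (2 * y * Real.sin θ)) := by
  have h : HasSum
      (fun n : ℕ => ∫ θ in (0 : ℝ)..Real.pi, (2 * y * Real.sin θ) ^ (2 * n) / (2 * n).factorial)
      (∫ θ in (0 : ℝ)..Real.pi, Real.cosh (2 * y * Real.sin θ)) := by
    refine intervalIntegral.hasSum_integral_of_dominated_convergence
      (fun n _ => (2 * y) ^ (2 * n) / (2 * n).factorial) (fun n => ?_) (fun n => ?_) ?_ ?_ ?_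
    · exact Continuous.aestronglyMeasurable (by fun_prop)
    · refine .of_forall fun θ _ => ?_
      rw [Real.norm_eq_abs, abs_of_nonneg (by rw [pow_mul]; positivity), mul_pow, pow_mul (Real.sin θ)]
      gcongr
      refine mul_le_of_le_one_right (by rw [pow_mul]; positivity) ?_
      exact pow_le_one₀ (sq_nonneg _) (Real.sin_sq_le_one θ)
    · exact .of_forall fun θ _ => (Real.hasSum_cosh (2 * y)).summable
    · exact intervalIntegrable_const
    · exact .of_forall fun θ _ => Real.hasSum_cosh _
  refine (h.mul_left Real.pi⁻¹).congr_fun fun n => ?_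
  simp_rw [mul_pow (2 * y), div_eq_mul_inv, mul_right_comm _ (Real.sin _ ^ _)]
  rw [intervalIntegral.integral_const_mul, integral_sin_pow_two_mul_eq_factorial]
  have h1 : (n.factorial : ℝ) ≠ 0 := by positivity
  have h2 : ((2 * n).factorial : ℝ) ≠ 0 := by positivity
  have h4 : (4 : ℝ) ^ n = 2 ^ (2 * n) := by rw [pow_mul]; norm_num
  rw [h4, mul_pow 2 y]
  field_simp
  ring

lemma szaszL_eq_integral (m : ℕ) (x : ℝ) :
    szaszL m x = Real.pi⁻¹ * ∫ θ in (0 : ℝ)..Real.pi,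
      Real.exp (-(2 * (m * x))) * Real.cosh (2 * (m * x) * Real.sin θ) := by
  rw [intervalIntegral.integral_const_mul, mul_left_comm,
    ← ((hasSum_pow_div_factorial_sq (m * x)).mul_left _).tsum_eq, szaszL]
  refine tsum_congr fun k => ?_
  rw [szaszV, mul_div_assoc, mul_pow, ← Real.exp_nat_mul]
  congr 2
  push_cast
  ring

/-- The integrand of the Bessel integral after rescaling the angle by `s`. -/
noncomputable def besselKernel (s t : ℝ) : ℝ :=
  (Set.Ioc (-(s * (Real.pi / 2))) (s * (Real.pi / 2))).indicator
    (fun t => Real.exp (-(2 * s ^ 2)) * Real.cosh (2 * s ^ 2 * Real.cos (t / s))) t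

lemma integral_besselKernel {s : ℝ} (hs : 0 < s) :
    ∫ t, besselKernel s t = s * ∫ θ in (0 : ℝ)..Real.pi,
      Real.exp (-(2 * s ^ 2)) * Real.cosh (2 * s ^ 2 * Real.sin θ) := by
  have hπ := Real.pi_pos
  simp only [besselKernel]
  rw [MeasureTheory.integral_indicator measurableSet_Ioc,
    ← intervalIntegral.integral_of_le (by nlinarith [mul_pos hs hπ]),
    intervalIntegral.integral_comp_div
      (fun θ => Real.exp (-(2 * s ^ 2)) * Real.cosh (2 * s ^ 2 * Real.cos θ)) hs.ne',
    smul_eq_mul]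
  congr 1
  have h := intervalIntegral.integral_comp_add_right (a := -(Real.pi / 2)) (b := Real.pi / 2)
    (fun θ => Real.exp (-(2 * s ^ 2)) * Real.cosh (2 * s ^ 2 * Real.sin θ)) (Real.pi / 2)
  simp only [Real.sin_add_pi_div_two] at h
  convert h using 2
  · field_simp
  · field_simp
  · ring
  · ring

lemma exp_mul_cosh_eq (a c : ℝ) :
    Real.exp (-a) * Real.cosh (a * c) =
      (Real.exp (-(a * (1 - c))) + Real.exp (-(a * (1 + c)))) / 2 := by
  rw [Real.cosh_eq, mul_div_assoc', mul_add, ← Real.exp_add, ← Real.exp_add]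
  ring_nf

lemma norm_besselKernel_le {s : ℝ} (hs : 0 < s) (t : ℝ) :
    ‖besselKernel s t‖ ≤ Real.exp (-(4 / Real.pi ^ 2) * t ^ 2) := by
  have hπ := Real.pi_pos
  by_cases ht : t ∈ Set.Ioc (-(s * (Real.pi / 2))) (s * (Real.pi / 2))
  · rw [besselKernel, Set.indicator_of_mem ht, Real.norm_eq_abs,
      abs_of_nonneg (mul_nonneg (Real.exp_pos _).le (Real.cosh_pos _).le), exp_mul_cosh_eq]
    have h1 : -(Real.pi / 2) ≤ t / s := by
      rw [le_div_iff₀ hs]; linarith [ht.1]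
    have h2 : t / s ≤ Real.pi / 2 := by
      rw [div_le_iff₀ hs]; linarith [ht.2]
    have hc := Real.cos_nonneg_of_neg_pi_div_two_le_of_le h1 h2
    have hq := Real.cos_le_one_sub_mul_cos_sq (x := t / s) (abs_le.2 ⟨by linarith, by linarith⟩)
    have hle : Real.exp (-(2 * s ^ 2 * (1 + Real.cos (t / s)))) ≤
        Real.exp (-(2 * s ^ 2 * (1 - Real.cos (t / s)))) := by
      gcongr
      linarith
    have hgauss : Real.exp (-(2 * s ^ 2 * (1 - Real.cos (t / s)))) ≤
        Real.exp (-(4 / Real.pi ^ 2) * t ^ 2) := by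
      apply Real.exp_le_exp.2
      have hscale : 4 / Real.pi ^ 2 * t ^ 2 = 2 * s ^ 2 * (2 / Real.pi ^ 2 * (t / s) ^ 2) := by
        field_simp
        ring
      rw [neg_mul, hscale]
      gcongr
      linarith
    linarith
  · rw [besselKernel, Set.indicator_of_notMem ht, norm_zero]
    positivity

lemma tendsto_sq_mul_one_sub_cos_div (t : ℝ) :
    Tendsto (fun s : ℝ => 2 * s ^ 2 * (1 - Real.cos (t / s))) atTop (𝓝 (t ^ 2)) := by
  have hsinc : Tendsto (fun s : ℝ => t ^ 2 * Real.sinc (t / 2 / s) ^ 2) atTop (𝓝 (t ^ 2)) := by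
    have h0 : Tendsto (fun s : ℝ => t / 2 / s) atTop (𝓝 0) := tendsto_const_nhds.div_atTop tendsto_id
    simpa using (((Real.continuous_sinc.tendsto 0).comp h0).pow 2).const_mul (t ^ 2)
  refine hsinc.congr' ?_
  filter_upwards [eventually_gt_atTop 0] with s hs
  have hcos : Real.cos (t / s) = 1 - 2 * Real.sin (t / 2 / s) ^ 2 := by
    rw [show t / s = 2 * (t / 2 / s) by ring, Real.cos_two_mul, Real.cos_sq']
    ring
  rw [hcos]
  rcases eq_or_ne t 0 with rfl | ht
  · simp
  · rw [Real.sinc_of_ne_zero (by positivity)]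
    field_simp
    ring

lemma tendsto_besselKernel (t : ℝ) :
    Tendsto (fun s => besselKernel s t) atTop (𝓝 (Real.exp (-1 * t ^ 2) / 2)) := by
  have hsq : Tendsto (fun s : ℝ => 4 * s ^ 2) atTop atTop :=
    (tendsto_pow_atTop two_ne_zero).const_mul_atTop (by norm_num)
  have hq := tendsto_sq_mul_one_sub_cos_div t
  have hfar : Tendsto (fun s : ℝ => 2 * s ^ 2 * (1 + Real.cos (t / s))) atTop atTop := by
    refine (hsq.atTop_add hq.neg).congr fun s => ?_
    ring
  have hsum := ((Real.continuous_exp.tendsto _).comp hq.neg).add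
    (Real.tendsto_exp_neg_atTop_nhds_zero.comp hfar) |>.div_const 2
  rw [add_zero, ← neg_one_mul] at hsum
  refine hsum.congr' ?_
  filter_upwards [eventually_gt_atTop |t|] with s hs
  have hs0 : 0 < s := (abs_nonneg t).trans_lt hs
  have hst : s < s * (Real.pi / 2) := by
    nlinarith [Real.pi_gt_three]
  rw [abs_lt] at hs
  rw [besselKernel, Set.indicator_of_mem (Set.mem_Ioc.2 ⟨by linarith, by linarith⟩), exp_mul_cosh_eq]
  rfl

lemma tendsto_integral_besselKernel :
    Tendsto (fun s => ∫ t, besselKernel s t) atTop (𝓝 (Real.sqrt Real.pi / 2)) := by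
  have hlim : ∫ t : ℝ, Real.exp (-1 * t ^ 2) / 2 = Real.sqrt Real.pi / 2 := by
    rw [MeasureTheory.integral_div, integral_gaussian, div_one]
  rw [← hlim]
  refine MeasureTheory.tendsto_integral_filter_of_dominated_convergence
    (fun t => Real.exp (-(4 / Real.pi ^ 2) * t ^ 2)) (.of_forall fun s => ?_) ?_
    (integrable_exp_neg_mul_sq (by positivity)) (.of_forall tendsto_besselKernel)
  · exact (Continuous.aestronglyMeasurable (by fun_prop)).indicator measurableSet_Ioc
  · filter_upwards [eventually_gt_atTop 0] with s hs
    exact .of_forall (norm_besselKernel_le hs)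

/-- For fixed `x ∈ (0,∞)`, `√(4πmx) · ∑_{k=0}^∞ V_{k,m}(x)² → 1` as `m → ∞`;
equivalently, `L_m^S(x) = m^{-1/2}((4πx)^{-1/2} + o_x(1))`. -/
theorem szaszL_asymptotic (x : ℝ) (hx : 0 < x) :
    Tendsto (fun m : ℕ => Real.sqrt (4 * Real.pi * m * x) * szaszL m x)
      atTop (𝓝 1) ∧
    Tendsto (fun m : ℕ => Real.sqrt m * szaszL m x)
      atTop (𝓝 ((Real.sqrt (4 * Real.pi * x))⁻¹)) := by
  have hfirst : Tendsto (fun m : ℕ => Real.sqrt (4 * Real.pi * m * x) * szaszL m x)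
      atTop (𝓝 1) := by
    have hs : Tendsto (fun m : ℕ => Real.sqrt (m * x)) atTop atTop :=
      Real.tendsto_sqrt_atTop.comp (tendsto_natCast_atTop_atTop.atTop_mul_const hx)
    have hlim := (tendsto_integral_besselKernel.comp hs).const_mul
      (Real.sqrt (4 * Real.pi) * Real.pi⁻¹)
    have hone : Real.sqrt (4 * Real.pi) * Real.pi⁻¹ * (Real.sqrt Real.pi / 2) = 1 := by
      rw [Real.sqrt_mul (by norm_num), show (4 : ℝ) = 2 ^ 2 by norm_num, Real.sqrt_sq (by norm_num)]
      have hsqrt := Real.mul_self_sqrt Real.pi_pos.le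
      field_simp
      linarith
    rw [hone] at hlim
    refine hlim.congr' ?_
    filter_upwards [eventually_gt_atTop 0] with m hm
    have hmx : 0 < (m : ℝ) * x := by positivity
    rw [Function.comp_apply, integral_besselKernel (Real.sqrt_pos.2 hmx), Real.sq_sqrt hmx.le,
      szaszL_eq_integral, mul_assoc (4 * Real.pi),
      Real.sqrt_mul (by positivity : 0 ≤ 4 * Real.pi)]
    ring
  refine ⟨hfirst, ?_⟩
  have hsecond := hfirst.const_mul (Real.sqrt (4 * Real.pi * x))⁻¹
  rw [mul_one] at hsecond
  refine hsecond.congr fun m => ?_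
  have hne : Real.sqrt (4 * Real.pi * x) ≠ 0 := by positivity
  rw [mul_right_comm (4 * Real.pi), Real.sqrt_mul (by positivity : 0 ≤ 4 * Real.pi * x)]
  field_simp
end

section
/- For each fixed x ∈ (0,∞), the quantity R̃_{1,m}^S(x) := m^{1/2} ∑_{k=0}^∞ ∑_{l=0}^∞ (min(k,l)/m − x) V_{k,m}(x) V_{l,m}(x) converges to −√(x/π) as m → ∞; consequently R_{1,m}^S(x) := m^{-1} ∑∑_{0 ≤ k < l < ∞} (k − mx) V_{k,m}(x) V_{l,m}(x) = m^{-1/2}(−√(x/(4π)) + o_x(1)). -/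
open Filter Topology

/-- `R̃_{1,m}^S(x) = m^{1/2} ∑_{k,l} (min(k,l)/m − x) V_{k,m}(x) V_{l,m}(x)`. -/
noncomputable def szaszRtilde (m : ℕ) (x : ℝ) : ℝ :=
  Real.sqrt m * ∑' k : ℕ, ∑' l : ℕ,
    ((min k l : ℝ) / m - x) * szaszV m k x * szaszV m l x

/-- `R_{1,m}^S(x) = m⁻¹ ∑∑_{0 ≤ k < l} (k − mx) V_{k,m}(x) V_{l,m}(x)`. -/
noncomputable def szaszR1 (m : ℕ) (x : ℝ) : ℝ :=
  (m : ℝ)⁻¹ * ∑' k : ℕ, ∑' l : ℕ,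
    if k < l then ((k : ℝ) - m * x) * szaszV m k x * szaszV m l x else 0

/-- The Poisson weight `e^{-a} a^k / k!`. -/
noncomputable def poissonWeight (a : ℝ) (k : ℕ) : ℝ :=
  Real.exp (-a) * a ^ k / (Nat.factorial k)

lemma szaszV_eq_poissonWeight (m k : ℕ) (x : ℝ) : szaszV m k x = poissonWeight (m * x) k := rfl

lemma poissonWeight_nonneg {a : ℝ} (ha : 0 ≤ a) (k : ℕ) : 0 ≤ poissonWeight a k := by
  unfold poissonWeight; positivity

lemma succ_mul_poissonWeight_succ (a : ℝ) (k : ℕ) :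
    ((k : ℝ) + 1) * poissonWeight a (k + 1) = a * poissonWeight a k := by
  unfold poissonWeight
  rw [Nat.factorial_succ]
  push_cast
  have : (k.factorial : ℝ) ≠ 0 := by positivity
  field_simp
  ring

lemma Real.hasSum_pow_div_factorial (y : ℝ) :
    HasSum (fun n : ℕ => y ^ n / (n.factorial : ℝ)) (Real.exp y) := by
  rw [Real.exp_eq_exp_ℝ]
  exact NormedSpace.expSeries_div_hasSum_exp y

lemma hasSum_poissonWeight (a : ℝ) : HasSum (poissonWeight a) 1 := by
  have h := (Real.hasSum_pow_div_factorial a).mul_left (Real.exp (-a))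
  rw [← Real.exp_add, neg_add_cancel, Real.exp_zero] at h
  simp only [← mul_div_assoc] at h
  exact h

/-- The upper tail of the Poisson weights strictly beyond `k`. -/
noncomputable def poissonTail (a : ℝ) (k : ℕ) : ℝ :=
  1 - ∑ i ∈ Finset.range (k + 1), poissonWeight a i

lemma poissonTail_zero (a : ℝ) : poissonTail a 0 = 1 - poissonWeight a 0 := by
  simp [poissonTail]

lemma poissonTail_succ (a : ℝ) (k : ℕ) :
    poissonTail a (k + 1) = poissonTail a k - poissonWeight a (k + 1) := by
  simp only [poissonTail, Finset.sum_range_succ _ (k + 1)]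
  ring

lemma hasSum_poissonTail (a : ℝ) (k : ℕ) :
    HasSum (fun l => if k < l then poissonWeight a l else 0) (poissonTail a k) := by
  refine (hasSum_nat_add_iff' (k + 1)).mp ?_
  have h := (hasSum_nat_add_iff' (k + 1)).mpr (hasSum_poissonWeight a)
  have hz : ∑ i ∈ Finset.range (k + 1), (if k < i then poissonWeight a i else 0) = 0 := by
    refine Finset.sum_eq_zero fun i hi => if_neg ?_
    have := Finset.mem_range.mp hi
    omega
  rw [hz, sub_zero]
  exact h.congr_fun fun n => if_pos (by omega)

lemma poissonTail_nonneg {a : ℝ} (ha : 0 ≤ a) (k : ℕ) : 0 ≤ poissonTail a k :=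
  (hasSum_poissonTail a k).nonneg fun l => by
    split_ifs
    exacts [poissonWeight_nonneg ha l, le_rfl]

lemma poissonTail_le_one {a : ℝ} (ha : 0 ≤ a) (k : ℕ) : poissonTail a k ≤ 1 :=
  sub_le_self _ (Finset.sum_nonneg fun i _ => poissonWeight_nonneg ha i)

lemma poissonWeight_le_one {a : ℝ} (ha : 0 ≤ a) (k : ℕ) : poissonWeight a k ≤ 1 :=
  le_hasSum (hasSum_poissonWeight a) k fun j _ => poissonWeight_nonneg ha j

lemma summable_poissonWeight_mul {a : ℝ} (ha : 0 ≤ a) {g : ℕ → ℝ} (h0 : ∀ k, 0 ≤ g k)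
    (h1 : ∀ k, g k ≤ 1) : Summable fun k => poissonWeight a k * g k :=
  (hasSum_poissonWeight a).summable.of_nonneg_of_le
    (fun k => mul_nonneg (poissonWeight_nonneg ha k) (h0 k))
    fun k => mul_le_of_le_one_right (poissonWeight_nonneg ha k) (h1 k)

lemma hasSum_sub_mul_poissonWeight_mul_poissonTail {a : ℝ} (ha : 0 ≤ a) :
    HasSum (fun k : ℕ => ((k : ℝ) - a) * poissonWeight a k * poissonTail a k)
      (-a * ∑' k, poissonWeight a k * poissonWeight a (k + 1)) := by
  have hA := (summable_poissonWeight_mul ha (fun k => poissonTail_nonneg ha (k + 1))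
    fun k => poissonTail_le_one ha (k + 1)).hasSum
  have hB := (summable_poissonWeight_mul ha (poissonTail_nonneg ha) (poissonTail_le_one ha)).hasSum
  have hP : ∑' k, poissonWeight a k * poissonWeight a (k + 1) =
      ∑' k, poissonWeight a k * poissonTail a k -
        ∑' k, poissonWeight a k * poissonTail a (k + 1) := by
    rw [← (hB.sub hA).tsum_eq]
    congr 1 with k
    rw [poissonTail_succ]
    ring
  have hB' := (hasSum_nat_add_iff' 1).mpr hB
  have h := ((hA.mul_left a).sub (hB'.mul_left a))
  refine (hasSum_nat_add_iff' 1).mp ?_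
  rw [hP]
  convert h using 1
  · ext k
    have := succ_mul_poissonWeight_succ a k
    push_cast
    linear_combination poissonTail a (k + 1) * this
  · simp
    ring

lemma hasSum_min_sub_mul_poissonWeight (a : ℝ) (k : ℕ) :
    HasSum (fun l : ℕ => (min (k : ℝ) l - a) * poissonWeight a l)
      (-a * poissonWeight a k + (k - a) * poissonTail a k) := by
  induction k with
  | zero =>
    have hz : -a * poissonWeight a 0 + (((0 : ℕ) : ℝ) - a) * poissonTail a 0 = -a * 1 := by
      rw [poissonTail_zero]
      push_cast
      ring
    rw [hz]
    exact ((hasSum_poissonWeight a).mul_left (-a)).congr_fun fun l => by simp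
  | succ k ih =>
    convert ih.add (hasSum_poissonTail a k) using 1
    · ext l
      split_ifs with h
      · have h' : (k : ℝ) + 1 ≤ l := by exact_mod_cast h
        push_cast
        rw [min_eq_left h', min_eq_left (by linarith)]
        ring
      · have h' : (l : ℝ) ≤ k := by exact_mod_cast not_lt.mp h
        push_cast
        rw [min_eq_right h', min_eq_right (by linarith)]
        ring
    · rw [poissonTail_succ]
      push_cast
      linear_combination -succ_mul_poissonWeight_succ a k

lemma szaszR1_eq {m : ℕ} {x : ℝ} (hx : 0 ≤ x) :
    szaszR1 m x = (m : ℝ)⁻¹ *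
      (-(m * x) * ∑' k, poissonWeight (m * x) k * poissonWeight (m * x) (k + 1)) := by
  unfold szaszR1
  congr 1
  rw [← (hasSum_sub_mul_poissonWeight_mul_poissonTail (by positivity : 0 ≤ m * x)).tsum_eq]
  congr 1 with k
  rw [← (hasSum_poissonTail (m * x) k).tsum_eq, ← tsum_mul_left]
  congr 1 with l
  simp only [szaszV_eq_poissonWeight]
  split_ifs <;> simp

lemma szaszRtilde_eq {m : ℕ} (hm : m ≠ 0) {x : ℝ} (hx : 0 ≤ x) :
    szaszRtilde m x = Real.sqrt m * ((m : ℝ)⁻¹ *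
      (-(m * x) * (∑' k, poissonWeight (m * x) k * poissonWeight (m * x) k +
        ∑' k, poissonWeight (m * x) k * poissonWeight (m * x) (k + 1)))) := by
  have ha : 0 ≤ m * x := by positivity
  have hm' : (m : ℝ) ≠ 0 := by exact_mod_cast hm
  unfold szaszRtilde
  congr 1
  have hA := (summable_poissonWeight_mul ha (poissonWeight_nonneg ha)
    (poissonWeight_le_one ha)).hasSum
  rw [mul_add, ← ((hA.mul_left (-(m * x))).add
    (hasSum_sub_mul_poissonWeight_mul_poissonTail ha)).tsum_eq, ← tsum_mul_left]
  congr 1 with k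
  have h := (hasSum_min_sub_mul_poissonWeight (m * x) k).mul_left
    ((m : ℝ)⁻¹ * poissonWeight (m * x) k)
  convert h.tsum_eq using 1
  · congr 1 with l
    simp only [szaszV_eq_poissonWeight]
    field_simp
  · ring

lemma integral_cos_pow_even_mul (k : ℕ) :
    (∫ θ in (0 : ℝ)..Real.pi, Real.cos θ ^ (2 * k)) * (4 ^ k * (k.factorial : ℝ) ^ 2) =
      Real.pi * ((2 * k).factorial : ℝ) := by
  induction k with
  | zero => simp
  | succ k ih =>
    rw [show 2 * (k + 1) = 2 * k + 2 by ring, integral_cos_pow, Nat.factorial_succ (2 * k + 1),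
      Nat.factorial_succ (2 * k), Nat.factorial_succ k]
    simp only [Real.sin_pi, Real.sin_zero, mul_zero, sub_zero, zero_div, zero_add]
    push_cast
    have h2 : (2 * (k : ℝ) + 2) ≠ 0 := by positivity
    field_simp
    linear_combination (4 * (k : ℝ) + 4) * ih

lemma integral_cos_pow_odd (k : ℕ) :
    ∫ θ in (0 : ℝ)..Real.pi, Real.cos θ ^ (2 * k + 1) = 0 := by
  induction k with
  | zero => simp
  | succ k ih =>
    rw [show 2 * (k + 1) + 1 = 2 * k + 1 + 2 by ring, integral_cos_pow, ih]
    simp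

lemma hasSum_integral_exp_mul_cos_pow {a : ℝ} (ha : 0 ≤ a) (j : ℕ) :
    HasSum (fun n : ℕ => Real.exp (-(2 * a)) * (2 * a) ^ n / n.factorial *
        ∫ θ in (0 : ℝ)..Real.pi, Real.cos θ ^ (n + j))
      (∫ θ in (0 : ℝ)..Real.pi, Real.exp (2 * a * (Real.cos θ - 1)) * Real.cos θ ^ j) := by
  simp_rw [← intervalIntegral.integral_const_mul]
  refine intervalIntegral.hasSum_integral_of_dominated_convergence
    (fun n _ => poissonWeight (2 * a) n) ?_ ?_ ?_ ?_ ?_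
  · intro n
    exact (by fun_prop : Continuous fun θ : ℝ => Real.exp (-(2 * a)) * (2 * a) ^ n /
      (n.factorial : ℝ) * Real.cos θ ^ (n + j)).aestronglyMeasurable
  · refine fun n => Filter.Eventually.of_forall fun θ _ => ?_
    have h0 : 0 ≤ poissonWeight (2 * a) n := poissonWeight_nonneg (by positivity) n
    change ‖poissonWeight (2 * a) n * Real.cos θ ^ (n + j)‖ ≤ _
    rw [norm_mul, Real.norm_of_nonneg h0, norm_pow]
    exact mul_le_of_le_one_right h0 (pow_le_one₀ (norm_nonneg _) (Real.abs_cos_le_one θ))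
  · exact Filter.Eventually.of_forall fun θ _ => (hasSum_poissonWeight (2 * a)).summable
  · simp
  · refine Filter.Eventually.of_forall fun θ _ => ?_
    have hE : Real.exp (2 * a * (Real.cos θ - 1)) * Real.cos θ ^ j =
        Real.exp (-(2 * a)) * Real.cos θ ^ j * Real.exp (2 * a * Real.cos θ) := by
      rw [mul_right_comm (Real.exp (-(2 * a))), ← Real.exp_add]
      ring_nf
    rw [hE]
    refine ((Real.hasSum_pow_div_factorial (2 * a * Real.cos θ)).mul_left
      (Real.exp (-(2 * a)) * Real.cos θ ^ j)).congr_fun fun n => ?_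
    rw [mul_pow _ (Real.cos θ), pow_add]
    ring

lemma integral_exp_mul_cos {a : ℝ} (ha : 0 ≤ a) :
    ∫ θ in (0 : ℝ)..Real.pi, Real.exp (2 * a * (Real.cos θ - 1)) * Real.cos θ ^ 0 =
      Real.pi * ∑' k, poissonWeight a k * poissonWeight a k := by
  have h := hasSum_integral_exp_mul_cos_pow ha 0
  have hi : Function.Injective fun k : ℕ => 2 * k := fun p q hpq => by
    simp only at hpq
    omega
  rw [← hi.hasSum_iff] at h
  · rw [← h.tsum_eq, ← tsum_mul_left]
    congr 1 with k
    have := integral_cos_pow_even_mul k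
    rw [← eq_div_iff (by positivity)] at this
    simp only [Function.comp_apply, add_zero, poissonWeight]
    rw [this, show -(2 * a) = -a + -a by ring, Real.exp_add, mul_pow, pow_mul 2 2 k]
    field_simp
    ring
  · intro n hn
    rcases Nat.even_or_odd' n with ⟨k, rfl | rfl⟩
    · exact (hn ⟨k, rfl⟩).elim
    · rw [add_zero, integral_cos_pow_odd, mul_zero]

lemma integral_exp_mul_cos_mul_cos {a : ℝ} (ha : 0 ≤ a) :
    ∫ θ in (0 : ℝ)..Real.pi, Real.exp (2 * a * (Real.cos θ - 1)) * Real.cos θ ^ 1 =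
      Real.pi * ∑' k, poissonWeight a k * poissonWeight a (k + 1) := by
  have h := hasSum_integral_exp_mul_cos_pow ha 1
  have hi : Function.Injective fun k : ℕ => 2 * k + 1 := fun p q hpq => by
    simp only at hpq
    omega
  rw [← hi.hasSum_iff] at h
  · rw [← h.tsum_eq, ← tsum_mul_left]
    congr 1 with k
    have := integral_cos_pow_even_mul (k + 1)
    rw [← eq_div_iff (by positivity), show 2 * (k + 1) = 2 * k + 1 + 1 by ring] at this
    simp only [Function.comp_apply, poissonWeight]
    rw [this, show -(2 * a) = -a + -a by ring, Real.exp_add, mul_pow,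
      Nat.factorial_succ (2 * k + 1), Nat.factorial_succ k, pow_succ 2 (2 * k), pow_mul 2 2 k]
    push_cast
    have h2 : (2 * (k : ℝ) + 1 + 1) ≠ 0 := by positivity
    field_simp
    ring
  · intro n hn
    rcases Nat.even_or_odd' n with ⟨k, rfl | rfl⟩
    · rw [integral_cos_pow_odd, mul_zero]
    · exact (hn ⟨k, rfl⟩).elim

lemma Real.self_mul_sinc (y : ℝ) : y * Real.sinc y = Real.sin y := by
  rcases eq_or_ne y 0 with rfl | hy
  · simp
  · rw [Real.sinc_of_ne_zero hy, mul_div_cancel₀ _ hy]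

lemma Real.cos_sub_one_eq (θ : ℝ) : Real.cos θ - 1 = -2 * Real.sin (θ / 2) ^ 2 := by
  have := Real.cos_two_mul_eq_one_sub (θ / 2)
  rw [mul_div_cancel₀ _ two_ne_zero] at this
  linarith

lemma cos_sub_one_le_of_nonneg_of_le_pi {θ : ℝ} (h0 : 0 ≤ θ) (h1 : θ ≤ Real.pi) :
    Real.cos θ - 1 ≤ -(2 / Real.pi ^ 2) * θ ^ 2 := by
  have h := Real.mul_le_sin (x := θ / 2) (by linarith) (by linarith)
  have h2 := pow_le_pow_left₀ (by positivity) h 2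
  rw [Real.cos_sub_one_eq]
  have : (2 / Real.pi * (θ / 2)) ^ 2 = θ ^ 2 / Real.pi ^ 2 := by ring
  rw [this] at h2
  have : -(2 / Real.pi ^ 2) * θ ^ 2 = -2 * (θ ^ 2 / Real.pi ^ 2) := by ring
  linarith

lemma tendsto_sq_mul_cos_div_sub_one (t : ℝ) :
    Tendsto (fun s : ℝ => 2 * s ^ 2 * (Real.cos (t / s) - 1)) atTop (𝓝 (-1 * t ^ 2)) := by
  have h0 : Tendsto (fun s : ℝ => t / s / 2) atTop (𝓝 0) := by
    simpa using (tendsto_const_nhds.div_atTop tendsto_id : Tendsto (fun s : ℝ => t / s)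
      atTop (𝓝 0)).div_const 2
  have h1 := (Real.continuous_sinc.tendsto 0).comp h0
  rw [Real.sinc_zero] at h1
  have h2 := (h1.pow 2).const_mul (-t ^ 2)
  rw [one_pow, mul_one] at h2
  rw [neg_one_mul]
  refine h2.congr' ?_
  filter_upwards [eventually_gt_atTop 0] with s hs
  simp only [Function.comp_apply]
  rw [Real.cos_sub_one_eq, ← Real.self_mul_sinc]
  field_simp

/-- The Laplace method for the integrals representing `e^{-2a} I_0(2a)` and `e^{-2a} I_1(2a)`,
with `a = s ^ 2`. -/
lemma tendsto_mul_integral_exp_mul_cos_pow (j : ℕ) :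
    Tendsto (fun s : ℝ => s * ∫ θ in (0 : ℝ)..Real.pi,
        Real.exp (2 * s ^ 2 * (Real.cos θ - 1)) * Real.cos θ ^ j)
      atTop (𝓝 (Real.sqrt Real.pi / 2)) := by
  have hlim := MeasureTheory.tendsto_integral_filter_of_dominated_convergence
    (μ := MeasureTheory.volume.restrict (Set.Ioi (0 : ℝ))) (l := (atTop : Filter ℝ))
    (F := fun s t => (Set.Ioc 0 (s * Real.pi)).indicator
      (fun t => Real.exp (2 * s ^ 2 * (Real.cos (t / s) - 1)) * Real.cos (t / s) ^ j) t)
    (f := fun t => Real.exp (-1 * t ^ 2))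
    (fun t => Real.exp (-(4 / Real.pi ^ 2) * t ^ 2)) ?_ ?_ ?_ ?_
  · rw [integral_gaussian_Ioi, div_one] at hlim
    refine hlim.congr' ?_
    filter_upwards [eventually_gt_atTop 0] with s hs
    rw [MeasureTheory.setIntegral_indicator measurableSet_Ioc,
      Set.inter_eq_self_of_subset_right Set.Ioc_subset_Ioi_self,
      ← intervalIntegral.integral_of_le (by positivity),
      intervalIntegral.integral_comp_div
        (fun θ => Real.exp (2 * s ^ 2 * (Real.cos θ - 1)) * Real.cos θ ^ j) hs.ne',
      zero_div, mul_div_cancel_left₀ _ hs.ne', smul_eq_mul]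
  · refine Filter.Eventually.of_forall fun s => ?_
    refine MeasureTheory.AEStronglyMeasurable.indicator ?_ measurableSet_Ioc
    exact Measurable.aestronglyMeasurable (by fun_prop)
  · filter_upwards [eventually_gt_atTop 0] with s hs
    refine Filter.Eventually.of_forall fun t => ?_
    by_cases ht : t ∈ Set.Ioc 0 (s * Real.pi)
    · rw [Set.indicator_of_mem ht, norm_mul, Real.norm_of_nonneg (Real.exp_pos _).le, norm_pow]
      refine (mul_le_of_le_one_right (Real.exp_pos _).le
        (pow_le_one₀ (norm_nonneg _) (Real.abs_cos_le_one _))).trans (Real.exp_le_exp.mpr ?_)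
      have h := cos_sub_one_le_of_nonneg_of_le_pi (div_nonneg ht.1.le hs.le)
        ((div_le_iff₀' hs).mpr ht.2)
      refine (mul_le_mul_of_nonneg_left h (by positivity)).trans_eq ?_
      field_simp
      ring
    · rw [Set.indicator_of_notMem ht, norm_zero]
      positivity
  · exact (integrable_exp_neg_mul_sq (by positivity)).restrict
  · refine (MeasureTheory.ae_restrict_mem measurableSet_Ioi).mono fun t ht => ?_
    have h0 : Tendsto (fun s : ℝ => t / s) atTop (𝓝 0) := tendsto_const_nhds.div_atTop tendsto_id
    have hc := ((Real.continuous_cos.tendsto 0).comp h0).pow j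
    rw [Real.cos_zero, one_pow] at hc
    have h := ((Real.continuous_exp.tendsto _).comp (tendsto_sq_mul_cos_div_sub_one t)).mul hc
    rw [mul_one] at h
    refine h.congr' ?_
    filter_upwards [eventually_ge_atTop (t / Real.pi), eventually_gt_atTop 0] with s hs hs0
    have hmem : t ∈ Set.Ioc 0 (s * Real.pi) := ⟨ht, (div_le_iff₀ Real.pi_pos).mp hs⟩
    rw [Set.indicator_of_mem hmem]
    rfl

lemma tendsto_sqrt_mul_of_integral_eq {j : ℕ} {S : ℝ → ℝ}
    (hS : ∀ a, 0 ≤ a → ∫ θ in (0 : ℝ)..Real.pi,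
      Real.exp (2 * a * (Real.cos θ - 1)) * Real.cos θ ^ j = Real.pi * S a)
    {x : ℝ} (hx : 0 < x) :
    Tendsto (fun m : ℕ => Real.sqrt m * ((m : ℝ)⁻¹ * (-(m * x) * S (m * x)))) atTop
      (𝓝 (-Real.sqrt (x / (4 * Real.pi)))) := by
  have hs : Tendsto (fun m : ℕ => Real.sqrt (m * x)) atTop atTop :=
    Real.tendsto_sqrt_atTop.comp (tendsto_natCast_atTop_atTop.atTop_mul_const hx)
  have h := ((tendsto_mul_integral_exp_mul_cos_pow j).comp hs).const_mul
    (-(Real.sqrt x / Real.pi))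
  have hlim : -(Real.sqrt x / Real.pi) * (Real.sqrt Real.pi / 2) =
      -Real.sqrt (x / (4 * Real.pi)) := by
    have h4 : Real.sqrt 4 = 2 := by
      rw [show (4 : ℝ) = 2 ^ 2 by norm_num]
      exact Real.sqrt_sq zero_le_two
    rw [Real.sqrt_div hx.le, Real.sqrt_mul (by norm_num), h4]
    have hp : Real.sqrt Real.pi ^ 2 = Real.pi := Real.sq_sqrt Real.pi_pos.le
    have hp0 : 0 < Real.sqrt Real.pi := Real.sqrt_pos.mpr Real.pi_pos
    have hpi := Real.pi_pos
    field_simp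
    rw [hp]
  rw [hlim] at h
  refine h.congr' ?_
  filter_upwards [eventually_ne_atTop 0] with m hm
  have hm' : (m : ℝ) ≠ 0 := by exact_mod_cast hm
  have ha : 0 ≤ m * x := by positivity
  have hx2 : Real.sqrt x ^ 2 = x := Real.sq_sqrt hx.le
  have hpi := Real.pi_ne_zero
  simp only [Function.comp_apply]
  rw [Real.sq_sqrt ha, hS _ ha, Real.sqrt_mul (Nat.cast_nonneg m)]
  field_simp
  rw [hx2]

/-- For fixed `x ∈ (0,∞)`, `R̃_{1,m}^S(x) → −√(x/π)` as `m → ∞`; consequently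
`R_{1,m}^S(x) = m^{-1/2}(−√(x/(4π)) + o_x(1))`, i.e.
`√m · R_{1,m}^S(x) → −√(x/(4π))`. -/
theorem szaszR1_asymptotic (x : ℝ) (hx : 0 < x) :
    Tendsto (fun m : ℕ => szaszRtilde m x) atTop (𝓝 (-Real.sqrt (x / Real.pi))) ∧
    Tendsto (fun m : ℕ => Real.sqrt m * szaszR1 m x) atTop
      (𝓝 (-Real.sqrt (x / (4 * Real.pi)))) := by
  have h0 := tendsto_sqrt_mul_of_integral_eq (fun a ha => integral_exp_mul_cos ha) hx
  have h1 := tendsto_sqrt_mul_of_integral_eq (fun a ha => integral_exp_mul_cos_mul_cos ha) hx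
  constructor
  · have hlim : -Real.sqrt (x / (4 * Real.pi)) + -Real.sqrt (x / (4 * Real.pi)) =
        -Real.sqrt (x / Real.pi) := by
      rw [show x / Real.pi = 2 ^ 2 * (x / (4 * Real.pi)) by field_simp; norm_num,
        Real.sqrt_mul (by norm_num), Real.sqrt_sq zero_le_two]
      ring
    rw [← hlim]
    refine (h0.add h1).congr' ?_
    filter_upwards [eventually_ne_atTop 0] with m hm
    rw [szaszRtilde_eq hm hx.le]
    ring
  · exact h1.congr fun m => by rw [szaszR1_eq hx.le]
end

section
/- For every a > 0 and every integer m ≥ 1, m^{1/2} ∫_0^∞ L_m^S(x) e^{-ax} dx = √(m/(a(a+4m))), where L_m^S(x) = ∑_{k=0}^∞ V_{k,m}(x)²; in particular, as m → ∞, m^{1/2} ∫_0^∞ L_m^S(x) e^{-ax} dx → 1/(2√a) = ∫_0^∞ (4πx)^{-1/2} e^{-ax} dx. -/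
open Filter Topology MeasureTheory

/-- The central binomial coefficients in terms of the binomial series of exponent `-1/2`. -/
theorem centralBinom_eq_four_pow_mul_choose (n : ℕ) :
    (n.centralBinom : ℝ) = 4 ^ n * Ring.choose ((1 / 2 : ℝ) + n - 1) n := by
  have key : ∀ n : ℕ, (n.factorial : ℝ) * n.centralBinom =
      4 ^ n * (ascPochhammer ℝ n).eval (1 / 2 : ℝ) := by
    intro n
    induction n with
    | zero => simp
    | succ n ih =>
      have h : ((n : ℝ) + 1) * (n + 1).centralBinom = 2 * (2 * n + 1) * n.centralBinom :=
        mod_cast Nat.succ_mul_centralBinom_succ n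
      rw [ascPochhammer_succ_eval, Nat.factorial_succ]
      push_cast
      linear_combination (n.factorial : ℝ) * h + 4 * (1 / 2 + (n : ℝ)) * ih
  have hc : Ring.choose ((1 / 2 : ℝ) + n - 1) n = Ring.multichoose (1 / 2 : ℝ) n := by
    rw [Ring.choose]
    congr 1
    ring
  have h2 := Ring.factorial_nsmul_multichoose_eq_ascPochhammer (1 / 2 : ℝ) n
  rw [Polynomial.ascPochhammer_smeval_eq_eval, nsmul_eq_mul] at h2
  have h0 : (n.factorial : ℝ) ≠ 0 := by positivity
  apply mul_left_cancel₀ h0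
  rw [key, hc, ← h2]
  ring

/-- The generating function of the central binomial coefficients. -/
theorem hasSum_centralBinom_mul_pow {q : ℝ} (hq : 4 * |q| < 1) :
    HasSum (fun n : ℕ ↦ (n.centralBinom : ℝ) * q ^ n) (1 / Real.sqrt (1 - 4 * q)) := by
  have hmem : 4 * q ∈ Metric.eball (0 : ℝ) 1 := by
    rw [← ENNReal.ofReal_one, Metric.eball_ofReal]
    simpa [abs_mul] using hq
  have h := (Real.one_div_one_sub_rpow_hasFPowerSeriesOnBall_zero (1 / 2)).hasSum hmem
  rw [zero_add, ← Real.sqrt_eq_rpow] at h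
  refine h.congr_fun fun n ↦ ?_
  simp only [FormalMultilinearSeries.ofScalars_apply_eq, smul_eq_mul,
    centralBinom_eq_four_pow_mul_choose, mul_pow]
  ring

theorem integral_pow_mul_exp_neg_mul_Ioi (n : ℕ) {r : ℝ} (hr : 0 < r) :
    ∫ x in Set.Ioi (0 : ℝ), x ^ n * Real.exp (-(r * x)) = n.factorial / r ^ (n + 1) := by
  have h := Real.integral_rpow_mul_exp_neg_mul_Ioi (a := n + 1) (by positivity) hr
  rw [Real.Gamma_nat_eq_factorial, add_sub_cancel_right] at h
  simp_rw [Real.rpow_natCast] at h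
  rw [h]
  norm_cast
  rw [one_div, inv_pow, div_eq_inv_mul]

theorem integrableOn_pow_mul_exp_neg_mul_Ioi (n : ℕ) {r : ℝ} (hr : 0 < r) :
    IntegrableOn (fun x : ℝ ↦ x ^ n * Real.exp (-(r * x))) (Set.Ioi 0) := by
  have h := integrableOn_rpow_mul_exp_neg_mul_rpow (p := 1) (s := n) (b := r)
    (by have := n.cast_nonneg (α := ℝ); linarith) one_pos hr
  simpa using h

theorem szaszV_sq_mul_exp (a : ℝ) (m k : ℕ) (x : ℝ) :
    szaszV m k x ^ 2 * Real.exp (-a * x) =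
      (m : ℝ) ^ (2 * k) / (k.factorial : ℝ) ^ 2 *
        (x ^ (2 * k) * Real.exp (-((2 * m + a) * x))) := by
  have h : Real.exp (-((2 * m + a) * x)) =
      Real.exp (-(m * x)) ^ 2 * Real.exp (-a * x) := by
    rw [← Real.exp_nat_mul, ← Real.exp_add]
    congr 1
    push_cast
    ring
  rw [h, szaszV, div_pow, mul_pow, mul_pow, mul_pow, ← pow_mul, ← pow_mul, mul_comm k 2]
  ring

theorem integral_szaszV_sq_mul_exp {a : ℝ} (ha : 0 < a) (m k : ℕ) :
    ∫ x in Set.Ioi (0 : ℝ), szaszV m k x ^ 2 * Real.exp (-a * x) =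
      1 / (2 * m + a) * (k.centralBinom * ((m / (2 * m + a)) ^ 2) ^ k) := by
  have hr : 0 < 2 * (m : ℝ) + a := by positivity
  simp_rw [szaszV_sq_mul_exp]
  rw [integral_const_mul, integral_pow_mul_exp_neg_mul_Ioi _ hr]
  have hc : (k.centralBinom : ℝ) * (k.factorial : ℝ) ^ 2 = (2 * k).factorial := by
    have h := Nat.choose_mul_factorial_mul_factorial (show k ≤ 2 * k by omega)
    rw [show 2 * k - k = k by omega] at h
    rw [Nat.centralBinom, ← h]
    push_cast
    ring
  rw [← hc, ← pow_mul, div_pow]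
  field_simp
  ring

/-- The Laplace transform of `szaszL m`. -/
theorem integral_szaszL_mul_exp {a : ℝ} (ha : 0 < a) (m : ℕ) :
    ∫ x in Set.Ioi (0 : ℝ), szaszL m x * Real.exp (-a * x) =
      1 / Real.sqrt (a * (a + 4 * m)) := by
  have hr : 0 < 2 * (m : ℝ) + a := by positivity
  have hq : 1 - 4 * ((m : ℝ) / (2 * m + a)) ^ 2 = a * (a + 4 * m) / (2 * m + a) ^ 2 := by
    field_simp
    ring
  have hs := (hasSum_centralBinom_mul_pow (q := ((m : ℝ) / (2 * m + a)) ^ 2) (by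
    rw [abs_of_nonneg (sq_nonneg _), ← sub_pos, hq]
    positivity)).mul_left (1 / (2 * (m : ℝ) + a))
  simp_rw [← integral_szaszV_sq_mul_exp ha] at hs
  have hint : ∀ k : ℕ, IntegrableOn (fun x ↦ szaszV m k x ^ 2 * Real.exp (-a * x))
      (Set.Ioi (0 : ℝ)) := fun k ↦ by
    simp_rw [szaszV_sq_mul_exp]
    exact (integrableOn_pow_mul_exp_neg_mul_Ioi (2 * k) hr).const_mul _
  have hI := hasSum_integral_of_summable_integral_norm hint (by
    refine hs.summable.congr fun k ↦ integral_congr_ae (ae_of_all _ fun x ↦ ?_)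
    exact (Real.norm_of_nonneg (by positivity)).symm)
  simp_rw [tsum_mul_right] at hI
  refine (hI.unique hs).trans ?_
  rw [hq, Real.sqrt_div' _ (by positivity), Real.sqrt_sq hr.le]
  field_simp

theorem integral_inv_sqrt_mul_exp {a : ℝ} (ha : 0 < a) :
    ∫ x in Set.Ioi (0 : ℝ), (Real.sqrt (4 * Real.pi * x))⁻¹ * Real.exp (-a * x) =
      1 / (2 * Real.sqrt a) := by
  have h := Real.integral_rpow_mul_exp_neg_mul_Ioi (a := 1 / 2) (by norm_num) ha
  have hcongr : ∀ x ∈ Set.Ioi (0 : ℝ),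
      (Real.sqrt (4 * Real.pi * x))⁻¹ * Real.exp (-a * x) =
        (2 * Real.sqrt Real.pi)⁻¹ * (x ^ ((1 / 2 : ℝ) - 1) * Real.exp (-(a * x))) := by
    intro x hx
    have h4 : Real.sqrt 4 = 2 := by
      rw [show (4 : ℝ) = 2 ^ 2 by norm_num, Real.sqrt_sq zero_le_two]
    rw [Real.sqrt_mul (by positivity), Real.sqrt_mul (by norm_num), h4,
      show (1 / 2 : ℝ) - 1 = -(1 / 2) by norm_num, Real.rpow_neg (le_of_lt hx),
      ← Real.sqrt_eq_rpow, mul_inv, mul_assoc, neg_mul]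
  rw [setIntegral_congr_fun measurableSet_Ioi hcongr, integral_const_mul, h,
    Real.Gamma_one_half_eq, ← Real.sqrt_eq_rpow, Real.sqrt_div zero_le_one, Real.sqrt_one]
  field_simp

/-- For every `a > 0` and every `m ≥ 1`,
`m^{1/2} ∫_0^∞ L_m^S(x) e^{-ax} dx = √(m/(a(a+4m)))`; in particular, as `m → ∞`,
`m^{1/2} ∫_0^∞ L_m^S(x) e^{-ax} dx → 1/(2√a) = ∫_0^∞ (4πx)^{-1/2} e^{-ax} dx`. -/
theorem szaszL_weighted_integral (a : ℝ) (ha : 0 < a) :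
    (∀ m : ℕ, 1 ≤ m →
      Real.sqrt m * ∫ x in Set.Ioi (0 : ℝ), szaszL m x * Real.exp (-a * x) =
        Real.sqrt (m / (a * (a + 4 * m)))) ∧
    Tendsto (fun m : ℕ =>
        Real.sqrt m * ∫ x in Set.Ioi (0 : ℝ), szaszL m x * Real.exp (-a * x))
      atTop (𝓝 (1 / (2 * Real.sqrt a))) ∧
    (∫ x in Set.Ioi (0 : ℝ), (Real.sqrt (4 * Real.pi * x))⁻¹ * Real.exp (-a * x)) =
      1 / (2 * Real.sqrt a) := by
  have hmain (m : ℕ) :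
      Real.sqrt m * ∫ x in Set.Ioi (0 : ℝ), szaszL m x * Real.exp (-a * x) =
        Real.sqrt (m / (a * (a + 4 * m))) := by
    rw [integral_szaszL_mul_exp ha, Real.sqrt_div m.cast_nonneg, mul_one_div]
  refine ⟨fun m _ ↦ hmain m, ?_, integral_inv_sqrt_mul_exp ha⟩
  simp_rw [hmain]
  have hlim : Tendsto (fun m : ℕ ↦ 1 / (a * (a / m + 4))) atTop (𝓝 (1 / (a * (0 + 4)))) :=
    tendsto_const_nhds.div
      (((tendsto_const_div_atTop_nhds_zero_nat a).add_const 4).const_mul a) (by positivity)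
  have hval : Real.sqrt (1 / (a * (0 + 4))) = 1 / (2 * Real.sqrt a) := by
    rw [Real.sqrt_eq_iff_eq_sq (by positivity) (by positivity), div_pow, mul_pow,
      Real.sq_sqrt ha.le]
    ring
  rw [← hval]
  refine (hlim.congr' ?_).sqrt
  filter_upwards [eventually_gt_atTop 0] with m hm
  have hm' : (0 : ℝ) < m := mod_cast hm
  field_simp
end
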